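/- Fix an integer η ≥ 2 and let û(υ) = υ/η + η/2 + 3/2 − 1/η. For υ > (η²+3η−2)/(2(η−1)) (so υ > û(υ)) and P̂max > 0, define ζ(υ) = [(η−1)(υ + η/2 − 1)/(ηυ(υ − û(υ)))]·(P̂max − η(υ−û(υ))²/(2(η−1)(υ+η/2−1))) and f(υ) = −[(υ − û(υ))/(υ(1+ζ(υ)))]·[((η−1)(υ+η/2−1)+2η)/(2η)] − [(η−1)(υ+η/2−1)/(η(1+ζ(υ)))]·ζ(υ) + η·ln(1+ζ(υ)) + (η/2+1)·ln(υ/û(υ)). Then on the set where ζ(υ) ≥ 0, f is strictly decreasing in υ. -/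

import Mathlib

noncomputable def uhatF (η υ : ℝ) : ℝ := υ / η + η / 2 + 3 / 2 - 1 / η

noncomputable def zetaF (η Pmax υ : ℝ) : ℝ :=
  (η - 1) * (υ + η / 2 - 1) / (η * υ * (υ - uhatF η υ)) *
    (Pmax - η * (υ - uhatF η υ) ^ 2 / (2 * (η - 1) * (υ + η / 2 - 1)))

noncomputable def fF (η Pmax υ : ℝ) : ℝ :=
  -((υ - uhatF η υ) / (υ * (1 + zetaF η Pmax υ))) *
      (((η - 1) * (υ + η / 2 - 1) + 2 * η) / (2 * η))
    - (η - 1) * (υ + η / 2 - 1) / (η * (1 + zetaF η Pmax υ)) * zetaF η Pmax υ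
    + η * Real.log (1 + zetaF η Pmax υ)
    + (η / 2 + 1) * Real.log (υ / uhatF η υ)

/-- The threshold `υ` as an affine function of the gap `d = υ - uhatF n υ`. -/
noncomputable def thresholdOfGap (n d : ℝ) : ℝ := n * (n + d) / (n - 1) - n / 2 + 1

/-- `zetaF n P υ` as a function of the gap `d = υ - uhatF n υ`. -/
noncomputable def zetaOfGap (n P d : ℝ) : ℝ :=
  (2 * P * (n + d) - d ^ 2) / (2 * thresholdOfGap n d * d)

/-- `fF n P υ` as a function of the gap `d = υ - uhatF n υ`. -/
noncomputable def fOfGap (n P d : ℝ) : ℝ :=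
  -(d / (thresholdOfGap n d * (1 + zetaOfGap n P d))) * ((n + d) / 2 + 1)
    - (n + d) * zetaOfGap n P d / (1 + zetaOfGap n P d)
    + n * Real.log (1 + zetaOfGap n P d)
    + (n / 2 + 1) * Real.log (thresholdOfGap n d / (thresholdOfGap n d - d))

lemma thresholdOfGap_gap {n : ℝ} (hn : 2 ≤ n) (υ : ℝ) :
    thresholdOfGap n (υ - uhatF n υ) = υ := by
  have h1 : n - 1 ≠ 0 := by linarith
  have h2 : n ≠ 0 := by linarith
  unfold thresholdOfGap uhatF
  field_simp
  ring

lemma gap_add {n : ℝ} (hn : 2 ≤ n) (υ : ℝ) :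
    (n - 1) * (υ + n / 2 - 1) = n * (n + (υ - uhatF n υ)) := by
  have h2 : n ≠ 0 := by linarith
  unfold uhatF
  field_simp
  ring

lemma gap_lt_gap {n : ℝ} (hn : 2 ≤ n) {x y : ℝ} (h : x < y) :
    x - uhatF n x < y - uhatF n y := by
  have := gap_add hn x
  have := gap_add hn y
  nlinarith

lemma gap_pos {n : ℝ} (hn : 2 ≤ n) {υ : ℝ} (h : (n ^ 2 + 3 * n - 2) / (2 * (n - 1)) < υ) :
    0 < υ - uhatF n υ := by
  rw [div_lt_iff₀ (by linarith)] at h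
  have := gap_add hn υ
  nlinarith

lemma lt_thresholdOfGap {n d : ℝ} (hn : 2 ≤ n) (hd : 0 ≤ d) : d < thresholdOfGap n d := by
  have h1 : 0 < n - 1 := by linarith
  have : n + d ≤ n * (n + d) / (n - 1) := by
    rw [le_div_iff₀ h1]
    nlinarith
  unfold thresholdOfGap
  linarith

lemma zetaF_eq_zetaOfGap {n P υ : ℝ} (hn : 2 ≤ n) (hd : 0 < υ - uhatF n υ) :
    zetaF n P υ = zetaOfGap n P (υ - uhatF n υ) := by
  have hυ := lt_thresholdOfGap hn hd.le
  have h := gap_add hn υ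
  rw [thresholdOfGap_gap hn] at hυ
  unfold zetaF zetaOfGap
  rw [mul_assoc 2 (n - 1), h, thresholdOfGap_gap hn]
  generalize υ - uhatF n υ = d at *
  have : υ ≠ 0 := by linarith
  have : n + d ≠ 0 := by linarith
  have : n ≠ 0 := by linarith
  field_simp

lemma fF_eq_fOfGap {n P υ : ℝ} (hn : 2 ≤ n) (hd : 0 < υ - uhatF n υ) :
    fF n P υ = fOfGap n P (υ - uhatF n υ) := by
  have h := gap_add hn υ
  have hn0 : n ≠ 0 := by linarith
  unfold fF fOfGap
  rw [zetaF_eq_zetaOfGap hn hd, h, thresholdOfGap_gap hn, sub_sub_cancel,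
    mul_div_mul_left _ _ hn0, ← mul_div_right_comm]
  congr 4
  field_simp

lemma zetaOfGap_nonneg_iff {n P d : ℝ} (hn : 2 ≤ n) (hd : 0 < d) :
    0 ≤ zetaOfGap n P d ↔ d ^ 2 ≤ 2 * P * (n + d) := by
  have := lt_thresholdOfGap hn hd.le
  unfold zetaOfGap
  rw [le_div_iff₀ (by nlinarith)]
  simp

lemma hasDerivAt_thresholdOfGap (n d : ℝ) : HasDerivAt (thresholdOfGap n) (n / (n - 1)) d := by
  unfold thresholdOfGap
  simpa using
    (((((hasDerivAt_id' d).const_add n).const_mul n).div_const (n - 1)).sub_const (n / 2)).add_const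
      (1 : ℝ)

lemma hasDerivAt_zetaOfGap {n P d : ℝ} (hn : 2 ≤ n) (hd : 0 < d) :
    HasDerivAt (zetaOfGap n P)
      (((2 * thresholdOfGap n d * zetaOfGap n P d * d + d ^ 2) / (n + d) - 2 * d
        - 2 * zetaOfGap n P d * (n / (n - 1) * d + thresholdOfGap n d))
          / (2 * thresholdOfGap n d * d)) d := by
  have hu : thresholdOfGap n d ≠ 0 := by linarith [lt_thresholdOfGap hn hd.le]
  have hnum := ((((hasDerivAt_id' d).const_add n).const_mul (2 * P)).sub ((hasDerivAt_id' d).pow 2))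
  have hden := ((hasDerivAt_thresholdOfGap n d).const_mul 2).mul (hasDerivAt_id' d)
  have h := hnum.div hden (by simp [hu, hd.ne'])
  have : n + d ≠ 0 := by linarith
  have : n - 1 ≠ 0 := by linarith
  refine h.congr_deriv ?_
  unfold zetaOfGap
  simp only [Pi.mul_apply, Pi.sub_apply, Pi.pow_apply]
  generalize thresholdOfGap n d = u at *
  field_simp
  ring

/-- The derivative of `fOfGap`, where `z` and `z'` are the values of `zetaOfGap` and of its
derivative, and `u` and `k` those of `thresholdOfGap` and of its derivative. -/
noncomputable def fOfGapDeriv (n d u k z z' : ℝ) : ℝ :=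
  -((n + d) / 2 + 1) / (u * (1 + z))
    + d * ((n + d) / 2 + 1) * (k / u + z' / (1 + z)) / (u * (1 + z))
    - d / (2 * u * (1 + z)) - z / (1 + z) - (n + d) * z' / (1 + z) ^ 2 + n * z' / (1 + z)
    + (n / 2 + 1) * (k / u - (k - 1) / (u - d))

lemma hasDerivAt_fOfGap {n P d z' : ℝ} (hn : 2 ≤ n) (hd : 0 < d) (hz : 0 ≤ zetaOfGap n P d)
    (hz' : HasDerivAt (zetaOfGap n P) z' d) :
    HasDerivAt (fOfGap n P)
      (fOfGapDeriv n d (thresholdOfGap n d) (n / (n - 1)) (zetaOfGap n P d) z') d := by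
  have hud := lt_thresholdOfGap hn hd.le
  have hu : thresholdOfGap n d ≠ 0 := by linarith
  have hud' : thresholdOfGap n d - d ≠ 0 := by linarith
  have hw : 1 + zetaOfGap n P d ≠ 0 := by linarith
  have hu' := hasDerivAt_thresholdOfGap n d
  have hid := hasDerivAt_id' d
  have hw' := hz'.const_add 1
  have hT := hid.const_add n
  have h := ((((hid.div (hu'.mul hw') (mul_ne_zero hu hw)).neg.mul
    ((hT.div_const 2).add_const 1)).sub ((hT.mul hz').div hw' hw)).add
      ((hw'.log hw).const_mul n)).add
        (((hu'.div (hu'.sub hid) hud').log (div_ne_zero hu hud')).const_mul (n / 2 + 1))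
  refine h.congr_deriv ?_
  unfold fOfGapDeriv
  simp only [Pi.mul_apply, Pi.sub_apply, Pi.neg_apply, Pi.div_apply]
  generalize n / (n - 1) = k at *
  generalize thresholdOfGap n d = u at *
  generalize zetaOfGap n P d = z at *
  field_simp
  ring

lemma fOfGapDeriv_neg {n d z : ℝ} (hn : 2 ≤ n) (hd : 0 < d) (hz : 0 ≤ z) :
    fOfGapDeriv n d (thresholdOfGap n d) (n / (n - 1)) z
      (((2 * thresholdOfGap n d * z * d + d ^ 2) / (n + d) - 2 * d
        - 2 * z * (n / (n - 1) * d + thresholdOfGap n d)) / (2 * thresholdOfGap n d * d)) < 0 := by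
  obtain ⟨e, he, rfl⟩ : ∃ e : ℝ, 0 ≤ e ∧ n = e + 2 := ⟨n - 2, by linarith, by ring⟩
  have hU : thresholdOfGap (e + 2) d
      = ((e + 2) * (e + 2 + d) - (e + 1) * e / 2) / (e + 1) := by
    unfold thresholdOfGap
    rw [show e + 2 - 1 = e + 1 by ring]
    field_simp
    ring
  rw [hU, show e + 2 - 1 = e + 1 by ring, ← neg_pos]
  have hA : 0 < (e + 2) * (e + 2 + d) - (e + 1) * e / 2 := by ring_nf; positivity
  have hB : 0 < (e + 2) * (e + 2 + d) - (e + 1) * e / 2 - (e + 1) * d := by ring_nf; positivity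
  obtain ⟨U, hUdef⟩ : ∃ U, U = (e + 2) * (e + 2 + d) - (e + 1) * e / 2 := ⟨_, rfl⟩
  rw [← hUdef] at hA hB ⊢
  have hsub : U / (e + 1) - d = (U - (e + 1) * d) / (e + 1) := by field_simp
  unfold fOfGapDeriv
  rw [hsub]
  obtain ⟨H, hH⟩ : ∃ H, H = U - (e + 1) * d := ⟨_, rfl⟩
  rw [← hH] at hB ⊢
  have key : 0 < -((((2 * U * z + (e + 1) * d) * (U * d - (e + 2) * (e + 2 + d) * d
        - U * (e + 2 + d)) - U * (e + 2 + d) * d * (e + 1)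
        + (e + 2) * (e + 1) * (e + 2 + d) * d ^ 2)
        * ((e + 1) * d * ((e + 2 + d) / 2 + 1) - d * U + (e + 2) * z * U) * H)
      + 2 * (e + 2 + d) * d * H * (1 + z) * (-((e + 2 + d) / 2 + 1) * U ^ 2 * (e + 1)
        + d * (e + 2) * ((e + 2 + d) / 2 + 1) * U * (e + 1) - d / 2 * U ^ 2 * (e + 1) - z * U ^ 3)
      + ((e + 2) / 2 + 1) * 2 * U ^ 2 * (e + 2 + d) * d * (U - (e + 2) * d) * (e + 1)
        * (1 + z) ^ 2) := by
    subst hH hUdef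
    ring_nf
    positivity
  refine (div_pos key (show 0 < (1 + z) ^ 2 * (2 * U ^ 3) * (e + 2 + d) * d * H by
    positivity)).trans_eq ?_
  have : U = H + (e + 1) * d := by linarith
  clear hsub key hU
  field_simp
  subst hH
  ring

lemma fOfGap_strictAntiOn {n P : ℝ} (hn : 2 ≤ n) (hP : 0 < P) :
    StrictAntiOn (fOfGap n P) {d | 0 < d ∧ 0 ≤ zetaOfGap n P d} := by
  have hderiv : ∀ d ∈ {d | 0 < d ∧ 0 ≤ zetaOfGap n P d}, HasDerivAt (fOfGap n P) _ d :=
    fun d hd => hasDerivAt_fOfGap hn hd.1 hd.2 (hasDerivAt_zetaOfGap hn hd.1)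
  refine strictAntiOn_of_deriv_neg (Set.OrdConnected.convex ⟨?_⟩)
    (fun d hd => (hderiv d hd).continuousAt.continuousWithinAt) fun d hd => ?_
  · rintro x ⟨hx, -⟩ y ⟨hy, hzy⟩ m ⟨hxm, hmy⟩
    have hm : 0 < m := hx.trans_le hxm
    refine ⟨hm, ?_⟩
    rw [zetaOfGap_nonneg_iff hn hy] at hzy
    rw [zetaOfGap_nonneg_iff hn hm]
    by_contra! h
    have h2 : 2 * P < m := by nlinarith [mul_pos hP (by linarith : (0 : ℝ) < n)]
    nlinarith
  · have hd := interior_subset hd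
    rw [(hderiv d hd).deriv]
    exact fOfGapDeriv_neg hn hd.1 hd.2

theorem f_strictly_decreasing
    (η : ℕ) (hη : 2 ≤ η) (Pmax : ℝ) (hP : 0 < Pmax) :
    StrictAntiOn (fF (η : ℝ) Pmax)
      {υ : ℝ | υ > ((η : ℝ) ^ 2 + 3 * η - 2) / (2 * ((η : ℝ) - 1))
        ∧ 0 ≤ zetaF (η : ℝ) Pmax υ} := by
  have hn : (2 : ℝ) ≤ η := by exact_mod_cast hη
  rintro x ⟨hx, hzx⟩ y ⟨hy, hzy⟩ hxy
  have hdx := gap_pos hn hx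
  have hdy := gap_pos hn hy
  rw [zetaF_eq_zetaOfGap hn hdx] at hzx
  rw [zetaF_eq_zetaOfGap hn hdy] at hzy
  rw [fF_eq_fOfGap hn hdx, fF_eq_fOfGap hn hdy]
  exact fOfGap_strictAntiOn hn hP ⟨hdx, hzx⟩ ⟨hdy, hzy⟩ (gap_lt_gap hn hxy)
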